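/- Under the setting of the deterministic minimum-solution-gap lemma, suppose in addition that D > 0, let N = T̄ − T₀ + 1, and take the diminishing step size β^{(T)} = β/T with β = D/(M·N^{1/2}) for all T ∈ {T₀, …, T̄}, with T₀ ≥ 1. Then min_{T ∈ {T₀,…,T̄}} ‖A^{(T)} − Ā‖_F ≤ D·M / (c·N^{1/2}). -/

import Mathlib

open Matrix

/-- The Frobenius inner product `⟨X, Y⟩ = tr(Xᵀ Y)` on `ℝ^{n×n}`. -/
noncomputable def finner {n : ℕ} (X Y : Matrix (Fin n) (Fin n) ℝ) : ℝ :=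
  (Xᵀ * Y).trace

/-- The Frobenius norm on `ℝ^{n×n}`. -/
noncomputable def fnorm {n : ℕ} (X : Matrix (Fin n) (Fin n) ℝ) : ℝ :=
  Real.sqrt (finner X X)

/-- `G` is a subgradient of `f : ℝ^{n×n} → ℝ` at `A` if
`f(B) ≥ f(A) + ⟨G, B − A⟩` for all `B`, with the Frobenius inner product. -/
def IsMatSubgradientAt {n : ℕ} (f : Matrix (Fin n) (Fin n) ℝ → ℝ)
    (G A : Matrix (Fin n) (Fin n) ℝ) : Prop :=
  ∀ B, f B ≥ f A + finner G (B - A)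

theorem finner_comm {n : ℕ} (X Y : Matrix (Fin n) (Fin n) ℝ) : finner X Y = finner Y X := by
  unfold finner
  rw [← trace_transpose, transpose_mul, transpose_transpose]

theorem finner_self_nonneg {n : ℕ} (X : Matrix (Fin n) (Fin n) ℝ) : 0 ≤ finner X X := by
  simp only [finner, trace, diag_apply, mul_apply, transpose_apply]
  exact Finset.sum_nonneg fun i _ => Finset.sum_nonneg fun j _ => mul_self_nonneg _

theorem fnorm_nonneg {n : ℕ} (X : Matrix (Fin n) (Fin n) ℝ) : 0 ≤ fnorm X :=
  Real.sqrt_nonneg _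

theorem fnorm_sq {n : ℕ} (X : Matrix (Fin n) (Fin n) ℝ) : fnorm X ^ 2 = finner X X :=
  Real.sq_sqrt (finner_self_nonneg X)

theorem fnorm_sub_smul_sq {n : ℕ} (X Y : Matrix (Fin n) (Fin n) ℝ) (b : ℝ) :
    fnorm (X - b • Y) ^ 2 = fnorm X ^ 2 - 2 * b * finner Y X + b ^ 2 * fnorm Y ^ 2 := by
  have h := finner_comm X Y
  simp only [fnorm_sq]
  simp only [finner, transpose_sub, transpose_smul, sub_mul, mul_sub, smul_mul, Matrix.mul_smul,
    trace_sub, trace_smul, smul_eq_mul] at h ⊢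
  rw [h]
  ring

/-- One subgradient step with step size `b` decreases the squared distance to `B`. -/
theorem IsMatSubgradientAt.fnorm_step_sq_le {n : ℕ} {f : Matrix (Fin n) (Fin n) ℝ → ℝ}
    {G A : Matrix (Fin n) (Fin n) ℝ} (h : IsMatSubgradientAt f G A)
    (B : Matrix (Fin n) (Fin n) ℝ) {b : ℝ} (hb : 0 ≤ b) :
    fnorm (A - b • G - B) ^ 2
      ≤ fnorm (A - B) ^ 2 - 2 * b * (f A - f B) + b ^ 2 * fnorm G ^ 2 := by
  have hB : f A - f B ≤ finner G (A - B) := by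
    have hneg : finner G (B - A) = -finner G (A - B) := by
      simp [finner, mul_sub, trace_sub]
    have := h B
    linarith
  rw [sub_right_comm, fnorm_sub_smul_sq]
  have := mul_le_mul_of_nonneg_left hB (by positivity : 0 ≤ 2 * b)
  linarith

/-- Deterministic core of Theorem 5 of the paper (diminishing step size): with
`N = T̄ − T₀ + 1`, `β^{(T)} = β/T`, `β = D/(M N^{1/2})` and
`D = ‖A^{(T₀)} − Ā‖_F > 0`, the minimum solution gap over `[T₀, T̄]` is at most
`D M / (c N^{1/2})`. -/
theorem min_solution_gap_diminishing_step {n : ℕ} (hn : 1 ≤ n)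
    (Abar : Matrix (Fin n) (Fin n) ℝ) (T₀ Tbar : ℕ)
    (hT₀ : 1 ≤ T₀) (hT : T₀ ≤ Tbar)
    (f : ℕ → Matrix (Fin n) (Fin n) ℝ → ℝ)
    (hconv : ∀ T ∈ Finset.Icc T₀ Tbar, ConvexOn ℝ Set.univ (f T))
    (β : ℕ → ℝ)
    (A G : ℕ → Matrix (Fin n) (Fin n) ℝ)
    (hiter : ∀ T ∈ Finset.Icc T₀ Tbar, A (T + 1) = A T - β T • G T)
    (hsub : ∀ T ∈ Finset.Icc T₀ Tbar, IsMatSubgradientAt (f T) (G T) (A T))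
    (M c : ℝ) (hM : 0 < M) (hc : 0 < c)
    (hGnorm : ∀ T ∈ Finset.Icc T₀ Tbar, fnorm (G T) ≤ M * (T : ℝ))
    (hsharp : ∀ T ∈ Finset.Icc T₀ Tbar,
      f T (A T) - f T Abar ≥ c * (T : ℝ) * fnorm (A T - Abar))
    (hD : 0 < fnorm (A T₀ - Abar))
    (hstep : ∀ T ∈ Finset.Icc T₀ Tbar,
      β T = (fnorm (A T₀ - Abar)
        / (M * Real.sqrt ((Tbar - T₀ + 1 : ℕ) : ℝ))) / (T : ℝ)) :
    (Finset.Icc T₀ Tbar).inf' (Finset.nonempty_Icc.mpr hT)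
        (fun T => fnorm (A T - Abar))
      ≤ fnorm (A T₀ - Abar) * M
          / (c * Real.sqrt ((Tbar - T₀ + 1 : ℕ) : ℝ)) := by
  set D := fnorm (A T₀ - Abar)
  set N : ℕ := Tbar - T₀ + 1 with hN
  have hNpos : (0 : ℝ) < N := by exact_mod_cast Nat.succ_pos _
  have hs : 0 < √(N : ℝ) := Real.sqrt_pos.mpr hNpos
  have hs2 : √(N : ℝ) ^ 2 = N := Real.sq_sqrt hNpos.le
  by_contra! hlt
  rw [Finset.lt_inf'_iff] at hlt
  have hdescent : ∀ T ∈ Finset.Icc T₀ Tbar,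
      fnorm (A (T + 1) - Abar) ^ 2 < fnorm (A T - Abar) ^ 2 - D ^ 2 / N := by
    intro T hTmem
    have hTpos : (0 : ℝ) < T := by
      exact_mod_cast hT₀.trans (Finset.mem_Icc.mp hTmem).1
    set b := D / (M * √(N : ℝ)) with hb
    have hbpos : 0 < b := by positivity
    have hβ : β T = b / T := hstep T hTmem
    have hβpos : 0 < β T := hβ ▸ div_pos hbpos hTpos
    have hβT : β T * T = b := by rw [hβ]; field_simp
    have hbM : b ^ 2 * M ^ 2 = D ^ 2 / N := by
      rw [hb]; field_simp; rw [hs2]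
    have hgap : D ^ 2 / N < b * c * fnorm (A T - Abar) := by
      calc D ^ 2 / N = b * c * (D * M / (c * √(N : ℝ))) := by
            rw [hb]; field_simp; rw [hs2]
        _ < _ := mul_lt_mul_of_pos_left (hlt T hTmem) (by positivity)
    have hgrad : β T ^ 2 * fnorm (G T) ^ 2 ≤ D ^ 2 / N := by
      calc β T ^ 2 * fnorm (G T) ^ 2 ≤ β T ^ 2 * (M * T) ^ 2 := by
            gcongr
            · exact fnorm_nonneg _
            · exact hGnorm T hTmem
        _ = (β T * T) ^ 2 * M ^ 2 := by ring
        _ = D ^ 2 / N := by rw [hβT, hbM]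
    have hval : b * c * fnorm (A T - Abar) ≤ β T * (f T (A T) - f T Abar) := by
      calc b * c * fnorm (A T - Abar) = β T * (c * T * fnorm (A T - Abar)) := by
            rw [← hβT]; ring
        _ ≤ _ := mul_le_mul_of_nonneg_left (hsharp T hTmem) hβpos.le
    have hdist := (hsub T hTmem).fnorm_step_sq_le Abar hβpos.le
    rw [← hiter T hTmem] at hdist
    linarith
  have htotal : ∀ k < N, fnorm (A (T₀ + k + 1) - Abar) ^ 2 < D ^ 2 - (k + 1) * (D ^ 2 / N) := by
    intro k hk
    induction k with
    | zero => simpa using hdescent T₀ (Finset.mem_Icc.mpr ⟨le_rfl, hT⟩)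
    | succ k ih =>
      have hprev := ih (by omega)
      have hnext := hdescent (T₀ + (k + 1)) (Finset.mem_Icc.mpr (by omega))
      push_cast
      rw [← add_assoc] at hnext ⊢
      linarith
  have hlast := htotal (Tbar - T₀) (by omega)
  have hcast : ((Tbar - T₀ : ℕ) : ℝ) + 1 = N := by rw [hN]; push_cast; ring
  rw [hcast, mul_div_cancel₀ _ hNpos.ne', sub_self] at hlast
  exact absurd hlast (sq_nonneg _).not_gt
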